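/- There exists a self-dual binary linear code C ⊆ F₂^{72} whose minimum nonzero Hamming weight is 12, which contains exactly 870 codewords of Hamming weight 12 and exactly 6336 codewords of Hamming weight 14 (the weight enumerator W_{72,1} with γ = 36 and β = 435). -/

import Mathlib

/-- A subspace `C` of `(ZMod 2)^ι` is self-dual if it equals its Euclidean dual. -/
def IsSelfDual {R : Type*} [CommRing R] {ι : Type*} [Fintype ι]
    (C : Submodule R (ι → R)) : Prop :=
  ∀ x, x ∈ C ↔ ∀ y ∈ C, ∑ i, x i * y i = 0

/-- The Hamming weight of a vector: the number of nonzero coordinates. -/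
def hamWt {ι : Type*} [Fintype ι] {R : Type*} [Zero R] [DecidableEq R] (v : ι → R) : ℕ :=
  (Finset.univ.filter fun i => v i ≠ 0).card

/-- The natural number whose binary digits, least significant first, are the entries of a list. -/
def pack : List Bool → ℕ
  | [] => 0
  | b :: l => Nat.bit b (pack l)

theorem testBit_pack (l : List Bool) (i : ℕ) : (pack l).testBit i = l.getD i false := by
  induction l generalizing i with
  | nil => simp [pack]
  | cons b l ih => cases i <;> simp [pack, Nat.testBit_bit_succ, ih]

theorem pack_append (l l' : List Bool) :
    pack (l ++ l') = pack l + pack l' <<< l.length := by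
  induction l with
  | nil => simp [pack]
  | cons b l ih =>
    simp only [List.cons_append, pack, ih, Nat.bit_val, List.length_cons, Nat.shiftLeft_eq,
      pow_succ]
    ring

theorem pack_map_not (l : List Bool) :
    pack (l.map not) = (1 <<< l.length - 1) ^^^ pack l := by
  refine Nat.eq_of_testBit_eq fun i => ?_
  rw [testBit_pack, Nat.testBit_xor, testBit_pack, Nat.one_shiftLeft, Nat.testBit_two_pow_sub_one]
  by_cases h : i < l.length
  · simp [h]
  · simp [h]

theorem pack_eq_zero {l : List Bool} (h : pack l = 0) : l.count true = 0 := by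
  rw [List.count_eq_zero]
  intro hm
  obtain ⟨i, hi, he⟩ := List.mem_iff_getElem.1 hm
  have := testBit_pack l i
  simp [h, hi, he] at this

theorem pack_drop (l : List Bool) (m : ℕ) : pack (l.drop m) = pack l >>> m := by
  refine Nat.eq_of_testBit_eq fun i => ?_
  simp [testBit_pack, List.getD_eq_getElem?_getD]

theorem pack_take (l : List Bool) (m : ℕ) :
    pack (l.take m) = pack l ^^^ (pack l >>> m) <<< m := by
  refine Nat.eq_of_testBit_eq fun i => ?_
  simp only [testBit_pack, List.getD_eq_getElem?_getD, Nat.testBit_xor, Nat.testBit_shiftLeft,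
    Nat.testBit_shiftRight, List.getElem?_take]
  by_cases h : i < m
  · simp [h, Nat.not_le.2 h]
  · simp [h, Nat.not_lt.1 h]

/-- The sum of `count` over the digits of `x` from position `m` on, which form the number `h`, and
over its first `m` digits. -/
def popCountSplit (count : ℕ → ℕ) (x h m : ℕ) : ℕ :=
  count h + count (x ^^^ h <<< m)

/-- The number of binary digits `1` of a number below `2 ^ 2 ^ d`. -/
def popCount : ℕ → ℕ → ℕ
  | 0, x => x
  | d + 1, x => cond (x.beq 0) 0 (popCountSplit (popCount d) x (x >>> (1 <<< d)) (1 <<< d))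

theorem popCount_pack (d : ℕ) (l : List Bool) (hl : l.length ≤ 2 ^ d) :
    popCount d (pack l) = l.count true := by
  induction d generalizing l with
  | zero =>
    match l, hl with
    | [], _ => rfl
    | [b], _ => cases b <;> rfl
  | succ d ih =>
    rw [popCount]
    by_cases h : pack l = 0
    · simp [h, pack_eq_zero h]
    · have hb : (pack l).beq 0 = false := Bool.eq_false_iff.2 fun e => h (Nat.eq_of_beq_eq_true e)
      rw [hb, cond_false, popCountSplit, Nat.one_shiftLeft, ← pack_take, ← pack_drop, ih, ih,
        add_comm, ← List.count_append, List.take_append_drop]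
      · simp
      · rw [List.length_drop]; rw [pow_succ] at hl; omega

/-- The exclusive or of a list of booleans. -/
def parity (l : List Bool) : Bool := l.foldr xor false

/-- The number of sublists of length `k` of `bs`, with the parities of these sublists packed
into a number. -/
def packedParities (bs : List Bool) (k : ℕ) : ℕ × ℕ :=
  ((bs.sublistsLen k).length, pack ((bs.sublistsLen k).map parity))

/-- The transition from `packedParities bs` to `packedParities (b :: bs)`, above the entry
`(l, c)`. -/
def parityStepAux (b : Bool) : ℕ → ℕ → List (ℕ × ℕ) → List (ℕ × ℕ)
  | _, _, [] => []
  | l, c, (l', c') :: t =>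
    (l' + l, c' + (cond b ((1 <<< l - 1) ^^^ c) c) <<< l') :: parityStepAux b l' c' t

/-- The transition from `packedParities bs` to `packedParities (b :: bs)`. -/
def parityStep (b : Bool) : List (ℕ × ℕ) → List (ℕ × ℕ)
  | [] => []
  | (l, c) :: t => (l, c) :: parityStepAux b l c t

/-- An efficient computation of `packedParities bs k` for all `k ≤ K`. -/
def parityTable (K : ℕ) (bs : List Bool) : List (ℕ × ℕ) :=
  bs.foldr parityStep ((1, 0) :: List.replicate K (0, 0))

theorem packedParities_cons_succ (b : Bool) (bs : List Bool) (k : ℕ) :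
    packedParities (b :: bs) (k + 1) =
      ((packedParities bs (k + 1)).1 + (packedParities bs k).1,
        (packedParities bs (k + 1)).2 +
          (cond b ((1 <<< (packedParities bs k).1 - 1) ^^^ (packedParities bs k).2)
            (packedParities bs k).2) <<< (packedParities bs (k + 1)).1) := by
  have hc : parity ∘ List.cons b = fun s => xor b (parity s) := rfl
  simp only [packedParities, List.sublistsLen_succ_cons, List.length_append, List.length_map,
    List.map_append, List.map_map, pack_append, hc]
  cases b
  · simp
  · have := pack_map_not ((bs.sublistsLen k).map parity)
    rw [List.map_map, List.length_map] at this
    simp only [cond_true, Bool.true_xor]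
    rw [← this]
    rfl

theorem parityStepAux_eq (b : Bool) (bs : List Bool) (k m : ℕ) :
    parityStepAux b (packedParities bs k).1 (packedParities bs k).2
        ((List.range' (k + 1) m).map (packedParities bs)) =
      (List.range' (k + 1) m).map (packedParities (b :: bs)) := by
  induction m generalizing k with
  | zero => rfl
  | succ m ih =>
    simp only [List.range'_succ, List.map_cons]
    rw [← ih (k + 1), packedParities_cons_succ]
    rfl

theorem parityTable_eq (K : ℕ) (bs : List Bool) :
    parityTable K bs = (List.range' 0 (K + 1)).map (packedParities bs) := by
  induction bs with
  | nil =>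
    have h (m k : ℕ) : (List.range' (k + 1) m).map (packedParities []) =
        List.replicate m (0, 0) := by
      induction m generalizing k with
      | zero => rfl
      | succ m ih => rw [List.range'_succ, List.map_cons, ih, List.replicate_succ]; rfl
    rw [List.range'_succ, List.map_cons, h]
    rfl
  | cons b bs ih =>
    have h : parityTable K (b :: bs) = parityStep b (parityTable K bs) := rfl
    rw [h, ih]
    simp only [List.range'_succ, List.map_cons, parityStep]
    rw [parityStepAux_eq]
    simp [packedParities]

/-- The number whose binary digits are the `i`-th digits of the numbers `ps`. -/
def sliceVal : List ℕ → ℕ → ℕ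
  | [], _ => 0
  | p :: ps, i => (p.testBit i).toNat + 2 * sliceVal ps i

/-- Bit-sliced addition of the digits of `c` to the counters `ps`. -/
def addBits : List ℕ → ℕ → List ℕ
  | [], c => cond (c.beq 0) [] [c]
  | p :: ps, c => (p ^^^ c) :: addBits ps (p &&& c)

theorem sliceVal_addBits (ps : List ℕ) (c i : ℕ) :
    sliceVal (addBits ps c) i = sliceVal ps i + (c.testBit i).toNat := by
  induction ps generalizing c with
  | nil =>
    by_cases h : c = 0
    · simp [addBits, sliceVal, h]
    · have hb : c.beq 0 = false := Bool.eq_false_iff.2 fun e => h (Nat.eq_of_beq_eq_true e)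
      simp [addBits, sliceVal, hb]
  | cons p ps ih =>
    simp only [addBits, sliceVal, ih, Nat.testBit_xor, Nat.testBit_land]
    cases p.testBit i <;> cases c.testBit i <;> simp <;> ring

/-- Restriction of the mask `e` to the positions where the digit of `p` is the last digit
of `w`. -/
def maskStep (w p e : ℕ) : ℕ :=
  cond ((w % 2).beq 1) (e &&& p) (e ^^^ (e &&& p))

/-- The mask of those `i < N` for which the bit-sliced counter has value `w`. -/
def eqMask (N : ℕ) : List ℕ → ℕ → ℕ
  | [], w => cond (w.beq 0) (1 <<< N - 1) 0
  | p :: ps, w => maskStep w p (eqMask N ps (w / 2))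

theorem testBit_eqMask (N : ℕ) (ps : List ℕ) (w i : ℕ) :
    (eqMask N ps w).testBit i = (decide (i < N) && decide (sliceVal ps i = w)) := by
  induction ps generalizing w with
  | nil =>
    rcases w with _ | w
    · simp [eqMask, sliceVal, Nat.one_shiftLeft, Nat.testBit_two_pow_sub_one]
    · have hb : (w + 1).beq 0 = false := rfl
      simp [eqMask, sliceVal, hb]
  | cons p ps ih =>
    rw [eqMask, maskStep]
    rcases Nat.mod_two_eq_zero_or_one w with h | h
    · rw [h, show Nat.beq 0 1 = false from rfl, cond_false, Nat.testBit_xor, Nat.testBit_land, ih,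
        sliceVal]
      cases p.testBit i
      · have : (false.toNat + 2 * sliceVal ps i = w) ↔ sliceVal ps i = w / 2 := by
          simp only [Bool.toNat_false]; omega
        simp only [this]
        simp
      · have : ¬ (true.toNat + 2 * sliceVal ps i = w) := by
          simp only [Bool.toNat_true]; omega
        simp only [this]
        simp
    · rw [h, show Nat.beq 1 1 = true from rfl, cond_true, Nat.testBit_land, ih, sliceVal]
      cases p.testBit i
      · have : ¬ (false.toNat + 2 * sliceVal ps i = w) := by
          simp only [Bool.toNat_false]; omega
        simp only [this]
        simp
      · have : (true.toNat + 2 * sliceVal ps i = w) ↔ sliceVal ps i = w / 2 := by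
          simp only [Bool.toNat_true]; omega
        simp only [this]
        simp

section Enumeration

variable {ι κ : Type}

/-- The weight, in the columns `js`, of the sum modulo `2` of the rows `s` of `f`. -/
def rowSumWt (f : ι → κ → Bool) (js : List κ) (s : List ι) : ℕ :=
  (js.map fun j => (parity (s.map fun i => f i j)).toNat).sum

/-- Addition of one column to all bit-sliced counters. -/
def addColumn : List (ℕ × List ℕ) → List (ℕ × ℕ) → List (ℕ × List ℕ)
  | (l, ps) :: t, (_, c) :: t' => (l, addBits ps c) :: addColumn t t'
  | _, _ => []

/-- For each `k ≤ K`, the number of `k`-element sublists `s` of `is` and a bit-sliced list of the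
values `rowSumWt f js s`. -/
def weightSlices (K : ℕ) (is : List ι) (js : List κ) (f : ι → κ → Bool) : List (ℕ × List ℕ) :=
  js.foldr (fun j t => addColumn t (parityTable K (is.map fun i => f i j)))
    ((parityTable K (is.map fun _ => false)).map fun p => (p.1, []))

/-- `p` consists of the number of `k`-element sublists of `is` and a bit-sliced list of the weights
of the corresponding sums of rows. -/
def IsWeightSlice (is : List ι) (js : List κ) (f : ι → κ → Bool) (k : ℕ) (p : ℕ × List ℕ) : Prop :=
  p.1 = (is.sublistsLen k).length ∧
    ∀ (i : ℕ) (hi : i < (is.sublistsLen k).length),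
      sliceVal p.2 i = rowSumWt f js (is.sublistsLen k)[i]

theorem sublistsLen_map (g : ι → κ) (k : ℕ) (l : List ι) :
    (l.map g).sublistsLen k = (l.sublistsLen k).map (List.map g) := by
  induction l generalizing k with
  | nil => cases k <;> simp
  | cons a l ih => cases k <;> simp [ih, Function.comp_def]

theorem packedParities_map (is : List ι) (g : ι → Bool) (k : ℕ) :
    packedParities (is.map g) k =
      ((is.sublistsLen k).length, pack ((is.sublistsLen k).map fun s => parity (s.map g))) := by
  rw [packedParities, sublistsLen_map, List.length_map, List.map_map]
  rfl

theorem forall₂_addColumn (is : List ι) (js : List κ) (f : ι → κ → Bool) (j : κ)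
    {ks : List ℕ} {t : List (ℕ × List ℕ)} (h : List.Forall₂ (IsWeightSlice is js f) ks t) :
    List.Forall₂ (IsWeightSlice is (j :: js) f) ks
      (addColumn t (ks.map (packedParities (is.map fun i => f i j)))) := by
  induction h with
  | nil => exact .nil
  | @cons k p ks t hp _ ih =>
    rw [List.map_cons]
    refine .cons ⟨hp.1, fun i hi => ?_⟩ ih
    change sliceVal (addBits p.2 (packedParities (is.map fun i => f i j) k).2) i = _
    rw [packedParities_map, sliceVal_addBits, hp.2 i hi, testBit_pack,
      List.getD_eq_getElem _ _ (by simpa using hi), List.getElem_map, add_comm]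
    rfl

theorem forall₂_weightSlices (K : ℕ) (is : List ι) (js : List κ) (f : ι → κ → Bool) :
    List.Forall₂ (IsWeightSlice is js f) (List.range' 0 (K + 1)) (weightSlices K is js f) := by
  induction js with
  | nil =>
    rw [weightSlices, List.foldr_nil, parityTable_eq, List.map_map, List.forall₂_map_right_iff,
      List.forall₂_same]
    intro k _
    refine ⟨congrArg Prod.fst (packedParities_map is _ k), fun i hi => ?_⟩
    simp [sliceVal, rowSumWt]
  | cons j js ih =>
    have := forall₂_addColumn is js f j ih
    rwa [← parityTable_eq] at this

theorem popCount_eqMask {is : List ι} {js : List κ} {f : ι → κ → Bool} {k : ℕ} {p : ℕ × List ℕ}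
    (hp : IsWeightSlice is js f k p) {d : ℕ} (hd : p.1 ≤ 2 ^ d) (w : ℕ) :
    popCount d (eqMask p.1 p.2 w) =
      (is.sublistsLen k).countP fun s => decide (rowSumWt f js s = w) := by
  have h : eqMask p.1 p.2 w =
      pack ((is.sublistsLen k).map fun s => decide (rowSumWt f js s = w)) := by
    refine Nat.eq_of_testBit_eq fun i => ?_
    rw [testBit_eqMask, testBit_pack, hp.1]
    by_cases hi : i < (is.sublistsLen k).length
    · rw [hp.2 i hi, List.getD_eq_getElem _ _ (by simpa using hi), List.getElem_map]
      simp only [hi, decide_true, Bool.true_and]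
    · rw [List.getD_eq_default _ _ (by simpa using hi)]
      simp only [hi, decide_false, Bool.false_and]
  rw [h, popCount_pack, List.count, List.countP_map]
  · congr 1
    ext s
    simp
  · rwa [List.length_map, ← hp.1]

/-- Comparison of the weight distribution of a bit-sliced list with a list of values, starting from
weight `w`. -/
def checkRow (p : ℕ × List ℕ) : ℕ → List ℕ → Bool
  | _, [] => true
  | w, c :: t => cond ((popCount 24 (eqMask p.1 p.2 w)).beq c) (checkRow p (w + 1) t) false

/-- Comparison of the weight distributions of bit-sliced lists with a table of values. -/
def checkTable : List (ℕ × List ℕ) → List (List ℕ) → Bool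
  | _, [] => true
  | [], _ :: _ => false
  | p :: t, r :: t' =>
    cond (p.1.ble 16777216) (cond (checkRow p 0 r) (checkTable t t') false) false

theorem popCount_of_checkRow {p : ℕ × List ℕ} {r : List ℕ} {w₀ : ℕ}
    (h : checkRow p w₀ r = true) (w : ℕ) (hw : w < r.length) :
    popCount 24 (eqMask p.1 p.2 (w₀ + w)) = r[w] := by
  induction r generalizing w₀ w with
  | nil => simp at hw
  | cons c t ih =>
    rw [checkRow, Bool.cond_false_right, Bool.and_eq_true] at h
    cases w with
    | zero => simpa using h.1
    | succ w =>
      have := ih h.2 w (by simpa using hw)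
      rw [add_assoc, add_comm 1] at this
      simpa using this

theorem countP_of_checkTable {is : List ι} {js : List κ} {f : ι → κ → Bool} {k₀ m : ℕ}
    {t : List (ℕ × List ℕ)} (ht : List.Forall₂ (IsWeightSlice is js f) (List.range' k₀ m) t)
    {rs : List (List ℕ)} (h : checkTable t rs = true) (k : ℕ) (hk : k < rs.length)
    (w : ℕ) (hw : w < rs[k].length) :
    ((is.sublistsLen (k₀ + k)).countP fun s => decide (rowSumWt f js s = w)) = rs[k][w] := by
  induction rs generalizing k₀ m t k with
  | nil => simp at hk
  | cons r rs ih =>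
    cases ht' : t with
    | nil => simp [ht', checkTable] at h
    | cons p t' =>
      subst ht'
      cases m with
      | zero => simp at ht
      | succ m =>
        rw [List.range'_succ, List.forall₂_cons] at ht
        rw [checkTable, Bool.cond_false_right, Bool.cond_false_right, Bool.and_eq_true,
          Bool.and_eq_true] at h
        cases k with
        | zero =>
          have hb : p.1 ≤ 2 ^ 24 := Nat.le_of_ble_eq_true h.1
          have := popCount_of_checkRow h.2.1 w hw
          rw [zero_add, popCount_eqMask ht.1 hb] at this
          exact this
        | succ k =>
          have := ih ht.2 h.2.2 k (by simpa using hk) hw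
          rw [add_assoc, add_comm 1] at this
          exact this

end Enumeration

section Vectors

variable {n : ℕ}

theorem hamWt_eq_sum {m : ℕ} (v : Fin m → ZMod 2) : hamWt v = ∑ i, if v i ≠ 0 then 1 else 0 := by
  rw [hamWt, Finset.card_filter]

theorem hamWt_append {m : ℕ} (u : Fin m → ZMod 2) (v : Fin n → ZMod 2) :
    hamWt (Fin.append u v) = hamWt u + hamWt v := by
  simp only [hamWt_eq_sum, Fin.sum_univ_add, Fin.append_left, Fin.append_right]

/-- The number of vectors `a` of weight `k` such that `a ᵥ* M` has weight `w`. -/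
def weightCount (M : Matrix (Fin n) (Fin n) (ZMod 2)) (k w : ℕ) : ℕ :=
  (Finset.univ.filter fun a : Fin n → ZMod 2 => hamWt a = k ∧ hamWt (Matrix.vecMul a M) = w).card

/-- The binary matrix with `1` at the positions where `f` is `true`. -/
def boolMatrix (f : Fin n → Fin n → Bool) : Matrix (Fin n) (Fin n) (ZMod 2) :=
  Matrix.of fun i j => ((f i j).toNat : ZMod 2)

/-- The characteristic vector of a set. -/
def charVec (S : Finset (Fin n)) : Fin n → ZMod 2 := fun i => if i ∈ S then 1 else 0

theorem charVec_injective : Function.Injective (charVec (n := n)) := by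
  intro S T h
  ext i
  have := congrFun h i
  by_cases hS : i ∈ S <;> by_cases hT : i ∈ T <;> simp_all [charVec]

theorem charVec_filter (a : Fin n → ZMod 2) :
    charVec (Finset.univ.filter fun i => a i ≠ 0) = a := by
  ext i : 1
  by_cases h : a i = 0
  · simp [charVec, h]
  · have : ∀ z : ZMod 2, z ≠ 0 → z = 1 := by decide
    simp [charVec, this _ h]

theorem hamWt_charVec (S : Finset (Fin n)) : hamWt (charVec S) = S.card := by
  simp [hamWt, charVec]

theorem vecMul_charVec (S : Finset (Fin n)) (M : Matrix (Fin n) (Fin n) (ZMod 2)) (j : Fin n) :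
    Matrix.vecMul (charVec S) M j = (S.val.map fun i => M i j).sum := by
  change ∑ i, charVec S i * M i j = ∑ i ∈ S, M i j
  simp [charVec]

theorem cast_parity (l : List Bool) :
    ((parity l).toNat : ZMod 2) = (l.map fun b => (b.toNat : ZMod 2)).sum := by
  induction l with
  | nil => rfl
  | cons b l ih =>
    rw [List.map_cons, List.sum_cons, ← ih]
    change ((xor b (parity l)).toNat : ZMod 2) = _
    cases b <;> cases parity l <;> decide

theorem rowSumWt_eq (f : Fin n → Fin n → Bool) (s : List (Fin n)) :
    rowSumWt f (List.finRange n) s =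
      ∑ j, if ((s : Multiset (Fin n)).map fun i => boolMatrix f i j).sum ≠ 0 then 1 else 0 := by
  rw [Fin.sum_univ_def, rowSumWt]
  congr 1
  refine List.map_congr_left fun j _ => ?_
  have h : ((s : Multiset (Fin n)).map fun i => boolMatrix f i j).sum =
      ((parity (s.map fun i => f i j)).toNat : ZMod 2) := by
    rw [cast_parity, List.map_map, Multiset.map_coe, Multiset.sum_coe]
    rfl
  rw [h]
  cases parity (s.map fun i => f i j) <;> simp

theorem weightCount_eq_countP (f : Fin n → Fin n → Bool) (k w : ℕ) :
    weightCount (boolMatrix f) k w =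
      ((List.finRange n).sublistsLen k).countP
        fun s => decide (rowSumWt f (List.finRange n) s = w) := by
  let Q : Multiset (Fin n) → Prop := fun s =>
    (∑ j, if (s.map fun i => boolMatrix f i j).sum ≠ 0 then 1 else 0) = w
  have h₁ : weightCount (boolMatrix f) k w =
      ((Finset.univ.powersetCard k).filter fun S : Finset (Fin n) => Q S.val).card := by
    rw [weightCount]
    symm
    refine Finset.card_bij (fun S _ => charVec S) ?_ (fun S _ T _ h => charVec_injective h) ?_
    · intro S hS
      rw [Finset.mem_filter, Finset.mem_powersetCard] at hS
      refine Finset.mem_filter.2 ⟨Finset.mem_univ _, (hamWt_charVec S).trans hS.1.2, ?_⟩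
      simpa only [hamWt_eq_sum, vecMul_charVec] using hS.2
    · intro a ha
      rw [Finset.mem_filter] at ha
      refine ⟨Finset.univ.filter fun i => a i ≠ 0, ?_, charVec_filter a⟩
      rw [Finset.mem_filter, Finset.mem_powersetCard]
      refine ⟨⟨Finset.subset_univ _, ha.2.1⟩, ?_⟩
      have := ha.2.2
      rw [← charVec_filter a] at this
      simpa only [hamWt_eq_sum, vecMul_charVec] using this
  have h₂ : ((Finset.univ.powersetCard k).filter fun S : Finset (Fin n) => Q S.val).card =
      ((Finset.univ.powersetCard k).val.map Finset.val).countP Q := by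
    rw [Multiset.countP_map]
    rfl
  have h₃ : (Finset.univ : Finset (Fin n)).val = (List.finRange n : Multiset (Fin n)) := rfl
  rw [h₁, h₂, Finset.map_val_val_powersetCard, h₃, Multiset.powersetCard_coe, Multiset.coe_countP,
    List.countP_map]
  congr 1
  ext s
  simp only [Function.comp_apply, rowSumWt_eq, Q]

theorem weightCount_of_checkTable {K : ℕ} {f : Fin n → Fin n → Bool} {rs : List (List ℕ)}
    (h : checkTable (weightSlices K (List.finRange n) (List.finRange n) f) rs = true)
    (k : ℕ) (hk : k < rs.length) (w : ℕ) (hw : w < rs[k].length) :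
    weightCount (boolMatrix f) k w = rs[k][w] := by
  have := countP_of_checkTable (forall₂_weightSlices K _ _ f) h k hk w hw
  rwa [zero_add, ← weightCount_eq_countP] at this

theorem vecMul_vecMul_transpose {M : Matrix (Fin n) (Fin n) (ZMod 2)} (hM : M * M.transpose = 1)
    (a : Fin n → ZMod 2) : Matrix.vecMul (Matrix.vecMul a M) M.transpose = a := by
  rw [Matrix.vecMul_vecMul, hM, Matrix.vecMul_one]

theorem weightCount_transpose {M : Matrix (Fin n) (Fin n) (ZMod 2)} (hM : M * M.transpose = 1)
    (k w : ℕ) : weightCount M k w = weightCount M.transpose w k := by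
  have hM' : M.transpose * M = 1 := mul_eq_one_comm.1 hM
  refine Finset.card_bij' (fun a _ => Matrix.vecMul a M) (fun b _ => Matrix.vecMul b M.transpose)
    ?_ ?_ ?_ ?_
  · intro a ha
    simp only [Finset.mem_filter, Finset.mem_univ, true_and] at ha ⊢
    exact ⟨ha.2, by rw [vecMul_vecMul_transpose hM]; exact ha.1⟩
  · intro b hb
    simp only [Finset.mem_filter, Finset.mem_univ, true_and] at hb ⊢
    exact ⟨hb.2, by rw [Matrix.vecMul_vecMul, hM', Matrix.vecMul_one]; exact hb.1⟩
  · intro a _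
    exact vecMul_vecMul_transpose hM a
  · intro b _
    rw [Matrix.vecMul_vecMul, hM', Matrix.vecMul_one]

/-- The code generated by the rows of `[I | M]`. -/
def systematicCode (M : Matrix (Fin n) (Fin n) (ZMod 2)) :
    Submodule (ZMod 2) (Fin (n + n) → ZMod 2) where
  carrier := Set.range fun a => Fin.append a (Matrix.vecMul a M)
  zero_mem' := ⟨0, by
    ext i
    refine Fin.addCases (fun i => ?_) (fun i => ?_) i <;>
      simp [-Fin.natAdd_eq_addNat]⟩
  add_mem' := by
    rintro _ _ ⟨a, rfl⟩ ⟨b, rfl⟩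
    refine ⟨a + b, ?_⟩
    ext i
    refine Fin.addCases (fun i => ?_) (fun i => ?_) i <;>
      simp [-Fin.natAdd_eq_addNat, Matrix.add_vecMul]
  smul_mem' := by
    rintro c _ ⟨a, rfl⟩
    refine ⟨c • a, ?_⟩
    ext i
    refine Fin.addCases (fun i => ?_) (fun i => ?_) i <;>
      simp [-Fin.natAdd_eq_addNat, Matrix.smul_vecMul]

theorem isSelfDual_systematicCode {M : Matrix (Fin n) (Fin n) (ZMod 2)}
    (hM : M * M.transpose = 1) : IsSelfDual (systematicCode M) := by
  have key (u v b : Fin n → ZMod 2) :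
      ∑ i, Fin.append u v i * Fin.append b (Matrix.vecMul b M) i =
        dotProduct (u + Matrix.vecMul v M.transpose) b := by
    rw [Fin.sum_univ_add, add_dotProduct, Matrix.vecMul_transpose,
      dotProduct_comm (Matrix.mulVec M v), Matrix.dotProduct_mulVec,
      dotProduct_comm (Matrix.vecMul b M)]
    simp only [Fin.append_left, Fin.append_right]
    rfl
  intro x
  obtain ⟨u, v, rfl⟩ : ∃ u v : Fin n → ZMod 2, x = Fin.append u v :=
    ⟨_, _, Fin.append_castAdd_natAdd.symm⟩
  constructor
  · rintro ⟨a, ha⟩ _ ⟨b, rfl⟩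
    rw [← ha, key, vecMul_vecMul_transpose hM]
    simp [CharTwo.add_self_eq_zero]
  · intro h
    have huv : u + Matrix.vecMul v M.transpose = 0 :=
      dotProduct_eq_zero _ fun b => (key u v b).symm.trans (h _ ⟨b, rfl⟩)
    have huv' : u = Matrix.vecMul v M.transpose :=
      funext fun i => CharTwo.add_eq_zero.1 (congrFun huv i)
    refine ⟨u, ?_⟩
    dsimp only
    rw [huv', Matrix.vecMul_vecMul, mul_eq_one_comm.1 hM, Matrix.vecMul_one]

theorem card_systematicCode (M : Matrix (Fin n) (Fin n) (ZMod 2)) (t : ℕ) :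
    Nat.card {v : Fin (n + n) → ZMod 2 // v ∈ systematicCode M ∧ hamWt v = t} =
      ∑ k ∈ Finset.range (t + 1), weightCount M k (t - k) := by
  let S := Finset.univ.filter fun a : Fin n → ZMod 2 => hamWt a + hamWt (Matrix.vecMul a M) = t
  have hS : Nat.card {v : Fin (n + n) → ZMod 2 // v ∈ systematicCode M ∧ hamWt v = t} = S.card := by
    rw [← Nat.card_eq_finsetCard]
    symm
    refine Nat.card_congr (Equiv.ofBijective
      (fun a => ⟨Fin.append a.1 (Matrix.vecMul a.1 M), ⟨a.1, rfl⟩, ?_⟩) ⟨?_, ?_⟩)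
    · rw [hamWt_append]
      exact (Finset.mem_filter.1 a.2).2
    · intro a b h
      refine Subtype.ext (funext fun i => ?_)
      simpa only [Fin.append_left] using congrFun (Subtype.ext_iff.1 h) (Fin.castAdd n i)
    · rintro ⟨_, ⟨a, rfl⟩, ha⟩
      rw [hamWt_append] at ha
      exact ⟨⟨a, Finset.mem_filter.2 ⟨Finset.mem_univ _, ha⟩⟩, rfl⟩
  rw [hS, Finset.card_eq_sum_card_fiberwise (f := hamWt) (t := Finset.range (t + 1))]
  · refine Finset.sum_congr rfl fun k hk => ?_
    rw [weightCount, Finset.filter_filter]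
    congr 1
    ext a
    simp only [Finset.mem_filter, Finset.mem_univ, true_and, Finset.mem_range] at hk ⊢
    omega
  · intro a ha
    have := (Finset.mem_filter.1 ha).2
    simp only [Finset.coe_range, Set.mem_Iio]
    omega

end Vectors

/-- The rows of a `36 × 36` matrix, which is the matrix of an element of the group algebra of the
dihedral group of order `36`, packed into a number. -/
def rowBits : ℕ :=
  434408508959360462656467459512796768415771126145579030204461199637186937503637696613003931620560163828388376728995274094907739326317852623139716094829041032563644139679756140743865844483890820899597221105806337631011153905672889561976479849430055139069644560605429427419818753072473751957360910989074861312095220195801312199185985787125662761617360752994984356269793484872907297369843600840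

/-- The entry in row `i` and column `j` of the matrix encoded by `rowBits`. -/
def rowEntry (i j : Fin 36) : Bool := rowBits.testBit (36 * i + j)

theorem rowMatrix_mul_transpose :
    boolMatrix rowEntry * (boolMatrix rowEntry).transpose = 1 := by
  have h : ∀ i k : Fin 36,
      parity ((List.finRange 36).map fun j => rowEntry i j && rowEntry k j) = decide (i = k) := by
    decide +kernel
  ext i k
  have := cast_parity ((List.finRange 36).map fun j => rowEntry i j && rowEntry k j)
  rw [h, List.map_map] at this
  rw [Matrix.mul_apply, Fin.sum_univ_def, Matrix.one_apply]
  refine Eq.trans (congrArg List.sum (List.map_congr_left fun j _ => ?_))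
    (this.symm.trans ?_)
  · simp only [boolMatrix, Matrix.of_apply, Matrix.transpose_apply, Function.comp_apply]
    cases rowEntry i j <;> cases rowEntry k j <;> simp
  · by_cases hik : i = k <;> simp [hik]

/-- The number of sums of `k ≤ 7` rows of weight `w ≤ 14 - k`. -/
def rowCounts : List (List ℕ) :=
  [[1, 0, 0, 0, 0, 0, 0, 0, 0, 0, 0, 0, 0, 0, 0],
   [0, 0, 0, 0, 0, 0, 0, 0, 0, 0, 0, 0, 0, 0],
   [0, 0, 0, 0, 0, 0, 0, 0, 0, 0, 18, 0, 0],
   [0, 0, 0, 0, 0, 0, 0, 0, 0, 0, 0, 324],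
   [0, 0, 0, 0, 0, 0, 0, 0, 234, 0, 0],
   [0, 0, 0, 0, 0, 0, 0, 0, 0, 1764],
   [0, 0, 0, 0, 0, 0, 312, 0, 0],
   [0, 0, 0, 0, 0, 0, 0, 2916]]

/-- The number of sums of `k ≤ 6` columns of weight `w ≤ 14 - k`. -/
def columnCounts : List (List ℕ) :=
  [[1, 0, 0, 0, 0, 0, 0, 0, 0, 0, 0, 0, 0, 0, 0],
   [0, 0, 0, 0, 0, 0, 0, 0, 0, 0, 0, 0, 0, 0],
   [0, 0, 0, 0, 0, 0, 0, 0, 0, 0, 18, 0, 0],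
   [0, 0, 0, 0, 0, 0, 0, 0, 0, 0, 0, 180],
   [0, 0, 0, 0, 0, 0, 0, 0, 288, 0, 0],
   [0, 0, 0, 0, 0, 0, 0, 0, 0, 1152],
   [0, 0, 0, 0, 0, 0, 312, 0, 0]]

theorem checkTable_rowCounts :
    checkTable (weightSlices 7 (List.finRange 36) (List.finRange 36) rowEntry) rowCounts = true := by
  decide +kernel

theorem checkTable_columnCounts :
    checkTable (weightSlices 6 (List.finRange 36) (List.finRange 36) fun j i => rowEntry i j)
      columnCounts = true := by
  decide +kernel

theorem weightCount_rowMatrix :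
    ∀ k < 15, ∀ w < 15 - k, weightCount (boolMatrix rowEntry) k w =
      if k < 8 then (rowCounts.getD k []).getD w 0 else (columnCounts.getD w []).getD k 0 := by
  intro k hk w hw
  split_ifs with h
  · have h₁ : k < rowCounts.length := h
    have h₂ : w < rowCounts[k].length := by
      revert k w
      decide
    rw [weightCount_of_checkTable checkTable_rowCounts k h₁ w h₂]
    simp [h₁, h₂]
  · have h₁ : w < columnCounts.length := by
      change w < 7
      omega
    have h₂ : k < columnCounts[w].length := by
      revert k w
      decide
    have := weightCount_of_checkTable checkTable_columnCounts w h₁ k h₂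
    rw [weightCount_transpose rowMatrix_mul_transpose]
    refine this.trans ?_
    simp [h₁, h₂]

theorem card_rowMatrix_code {t : ℕ} (ht : t < 15) :
    Nat.card {v : Fin 72 → ZMod 2 // v ∈ systematicCode (boolMatrix rowEntry) ∧ hamWt v = t} =
      ∑ k ∈ Finset.range (t + 1),
        if k < 8 then (rowCounts.getD k []).getD (t - k) 0
        else (columnCounts.getD (t - k) []).getD k 0 := by
  refine (card_systematicCode (boolMatrix rowEntry) t).trans (Finset.sum_congr rfl fun k hk => ?_)
  rw [Finset.mem_range] at hk
  exact weightCount_rowMatrix k (by omega) (t - k) (by omega)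

/-- There is a self-dual binary linear code of length 72 with minimum nonzero Hamming
weight 12, having exactly 870 codewords of weight 12 and exactly 6336 codewords of
weight 14 (weight enumerator `W_{72,1}` with γ = 36 and β = 435). -/
theorem exists_selfDual_code_72_gamma_36_beta_435 :
    ∃ C : Submodule (ZMod 2) (Fin 72 → ZMod 2),
      IsSelfDual C ∧
      IsLeast {k | ∃ v ∈ C, v ≠ 0 ∧ hamWt v = k} 12 ∧
      Nat.card {v : Fin 72 → ZMod 2 // v ∈ C ∧ hamWt v = 12} = 870 ∧
      Nat.card {v : Fin 72 → ZMod 2 // v ∈ C ∧ hamWt v = 14} = 6336 := by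
  have hwt : ∀ t, 0 < t → t < 12 → ∀ v ∈ systematicCode (boolMatrix rowEntry), hamWt v ≠ t := by
    intro t h₀ h₁ v hv ht
    have h := card_rowMatrix_code (t := t) (by omega)
    have h0 : ∑ k ∈ Finset.range (t + 1), (if k < 8 then (rowCounts.getD k []).getD (t - k) 0
        else (columnCounts.getD (t - k) []).getD k 0) = 0 := by
      clear h ht
      interval_cases t <;> rfl
    exact (Finite.card_eq_zero_iff.1 (h.trans h0)).elim ⟨v, hv, ht⟩
  have h12 : Nat.card {v : Fin 72 → ZMod 2 //
      v ∈ systematicCode (boolMatrix rowEntry) ∧ hamWt v = 12} = 870 :=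
    (card_rowMatrix_code (by norm_num)).trans (by decide)
  refine ⟨systematicCode (boolMatrix rowEntry), isSelfDual_systematicCode rowMatrix_mul_transpose,
    ⟨?_, ?_⟩, h12, (card_rowMatrix_code (by norm_num)).trans (by decide)⟩
  · have : Nonempty {v : Fin 72 → ZMod 2 //
        v ∈ systematicCode (boolMatrix rowEntry) ∧ hamWt v = 12} := by
      by_contra hn
      rw [not_nonempty_iff] at hn
      simp at h12
    obtain ⟨v, hv, hw⟩ := this
    refine ⟨v, hv, ?_, hw⟩
    rintro rfl
    simp [hamWt] at hw
  · rintro k ⟨v, hv, hne, rfl⟩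
    by_contra! hlt
    refine hwt _ ?_ hlt v hv rfl
    obtain ⟨i, hi⟩ := Function.ne_iff.1 hne
    exact Finset.card_pos.2 ⟨i, by simpa using hi⟩
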